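/- arXiv:1710.07854 — 2 statements merged into one kernel-verified Lean document; each statement's English description precedes it below -/
import Mathlib

section
/- The λ-open topology τ_λ makes (C(X,ℝ^ι),+) a quasitopological group (i.e., addition is separately continuous and negation f ↦ −f is continuous) if and only if every member of λ is C_ι-compact in X and λ = λ(C_ι). -/
open Topology Set

/-- The λ-open (set-open) topology on `C(X, ι → ℝ)` generated by the subbasis
`[A, U] = {f | f(A) ⊆ U}` for `A ∈ Λ` and `U` open in `ι → ℝ`. -/
def setOpenTopology {X : Type*} [TopologicalSpace X] (ι : Type*) (Λ : Set (Set X)) :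
    TopologicalSpace C(X, ι → ℝ) :=
  TopologicalSpace.generateFrom
    {S | ∃ A ∈ Λ, ∃ U : Set (ι → ℝ), IsOpen U ∧ S = {f : C(X, ι → ℝ) | Set.MapsTo f A U}}

/-- A subset `B ⊆ X` is `C_ι`-compact in `X` if `f(B)` is compact in `ℝ^ι`
for every continuous `f : X → ℝ^ι`. -/
def CCompactIn {X : Type*} [TopologicalSpace X] (ι : Type*) (B : Set X) : Prop :=
  ∀ f : C(X, ι → ℝ), IsCompact (⇑f '' B)

/-- The family `λ(C_ι)`. -/
def lambdaC {X : Type*} [TopologicalSpace X] (ι : Type*) (Λ : Set (Set X)) : Set (Set X) :=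
  {A | A ∈ Λ ∧ ∀ B ⊆ A, CCompactIn ι B → ∀ U : Set (ι → ℝ), IsOpen U →
    IsOpen[setOpenTopology ι Λ] {f : C(X, ι → ℝ) | Set.MapsTo f B U}}

section

variable {X ι : Type*} [TopologicalSpace X]

namespace CCompactIn

theorem isCompact_image_real [Nonempty ι] {B : Set X} (hB : CCompactIn ι B) (h : C(X, ℝ)) :
    IsCompact (h '' B) := by
  obtain ⟨i⟩ := ‹Nonempty ι›
  have := (hB ⟨fun x _ => h x, by fun_prop⟩).image (continuous_apply i)
  rwa [image_image] at this

/-- Images of `C_ι`-compact sets in proper metric spaces are compact. -/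
theorem isCompact_image_of_properSpace [Nonempty ι] {Y : Type*} [MetricSpace Y] [ProperSpace Y]
    {B : Set X} (hB : CCompactIn ι B) (F : C(X, Y)) : IsCompact (F '' B) := by
  rcases B.eq_empty_or_nonempty with rfl | ⟨b, -⟩
  · simp
  have hdist (y : Y) : IsCompact ((fun x => dist (F x) y) '' B) :=
    hB.isCompact_image_real ⟨fun x => dist (F x) y, by fun_prop⟩
  refine Metric.isCompact_of_isClosed_isBounded (isClosed_of_closure_subset fun y hy => ?_) ?_
  · have hmem : dist y y ∈ closure ((fun z => dist z y) '' (F '' B)) :=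
      image_closure_subset_closure_image (by fun_prop) (mem_image_of_mem _ hy)
    rw [image_image, (hdist y).isClosed.closure_eq, dist_self] at hmem
    obtain ⟨x, hx, hxy⟩ := hmem
    exact ⟨x, hx, dist_eq_zero.1 hxy⟩
  · obtain ⟨r, hr⟩ := (hdist (F b)).bddAbove
    refine (Metric.isBounded_iff_subset_closedBall (F b)).2 ⟨r, ?_⟩
    rintro _ ⟨x, hx, rfl⟩
    exact hr (mem_image_of_mem _ hx)

theorem isCompact_image_prodMk [Nonempty ι] {B : Set X} (hB : CCompactIn ι B)
    (f g : C(X, ι → ℝ)) : IsCompact ((fun x => (f x, g x)) '' B) := by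
  rcases finite_or_infinite ι with hι | hι
  · have := Fintype.ofFinite ι
    exact hB.isCompact_image_of_properSpace (f.prodMk g)
  · obtain ⟨e⟩ : Nonempty (ι ⊕ ι ≃ ι) := by
      rw [← Cardinal.eq, ← Cardinal.add_def]
      exact Cardinal.add_eq_self (Cardinal.aleph0_le_mk ι)
    let F : C(X, ι → ℝ) := ⟨fun x i => Sum.elim (f x) (g x) (e.symm i), by
      refine continuous_pi fun i => ?_
      rcases e.symm i with j | j
      · exact (continuous_apply j).comp f.continuous
      · exact (continuous_apply j).comp g.continuous⟩
    have hsplit : Continuous fun y : ι → ℝ =>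
        ((fun i => y (e (Sum.inl i))), fun i => y (e (Sum.inr i))) := by fun_prop
    have := (hB F).image hsplit
    rw [image_image] at this
    simpa [F] using this

theorem inter_preimage [Nonempty ι] {A : Set X} (hA : CCompactIn ι A) (h : C(X, ℝ))
    {T : Set ℝ} (hT : IsClosed T) : CCompactIn ι (A ∩ h ⁻¹' T) := by
  intro p
  obtain ⟨i⟩ := ‹Nonempty ι›
  have hc : IsClosed {q : (ι → ℝ) × (ι → ℝ) | q.2 i ∈ T} := hT.preimage (by fun_prop)
  have := ((hA.isCompact_image_prodMk p ⟨fun x _ => h x, by fun_prop⟩).inter_right hc).image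
    continuous_fst
  convert this using 1
  ext y
  simp only [mem_image, mem_inter_iff, mem_preimage, mem_ofPred_eq]
  constructor
  · rintro ⟨x, ⟨hx, hT⟩, rfl⟩
    exact ⟨_, ⟨⟨x, hx, rfl⟩, hT⟩, rfl⟩
  · rintro ⟨_, ⟨⟨x, hx, rfl⟩, hT⟩, rfl⟩
    exact ⟨x, ⟨hx, hT⟩, rfl⟩

end CCompactIn

theorem isOpen_setOpenTopology {Λ : Set (Set X)} {A : Set X} (hA : A ∈ Λ) {U : Set (ι → ℝ)}
    (hU : IsOpen U) : IsOpen[setOpenTopology ι Λ] {f : C(X, ι → ℝ) | MapsTo f A U} :=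
  TopologicalSpace.isOpen_generateFrom_of_mem ⟨A, hA, U, hU, rfl⟩

theorem continuous_neg_setOpenTopology (Λ : Set (Set X)) :
    Continuous[setOpenTopology ι Λ, setOpenTopology ι Λ] (fun f : C(X, ι → ℝ) => -f) := by
  refine continuous_generateFrom_iff.2 ?_
  rintro _ ⟨A, hA, U, hU, rfl⟩
  exact isOpen_setOpenTopology hA (hU.preimage continuous_neg)

theorem continuous_add_right_setOpenTopology [Nonempty ι] {Λ : Set (Set X)}
    (hc : ∀ A ∈ Λ, CCompactIn ι A) (hΛ : Λ = lambdaC ι Λ) (g : C(X, ι → ℝ)) :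
    Continuous[setOpenTopology ι Λ, setOpenTopology ι Λ] (fun f => f + g) := by
  refine continuous_generateFrom_iff.2 ?_
  rintro _ ⟨A, hA, U, hU, rfl⟩
  let := setOpenTopology (X := X) ι Λ
  refine isOpen_iff_mem_nhds.2 fun f hf => ?_
  have hadd : Continuous fun q : (ι → ℝ) × (ι → ℝ) => q.1 + q.2 := by fun_prop
  have key : ∀ q ∈ (fun x => (f x, g x)) '' A, ∃ φ : C((ι → ℝ) × (ι → ℝ), ℝ),
      ∃ V W : Set (ι → ℝ), IsOpen V ∧ (∀ y ∈ V, ∀ z ∈ W, y + z ∈ U) ∧ φ q < 1 / 2 ∧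
        ∀ q', φ q' ≤ 1 / 2 → q' ∈ V ×ˢ W := by
    rintro _ ⟨x, hx, rfl⟩
    obtain ⟨V, W, hV, hW, hxV, hxW, hVW⟩ :=
      isOpen_prod_iff.1 (hU.preimage hadd) (f x) (g x) (hf hx)
    obtain ⟨φ, hφ, hφ0, hφ1⟩ := CompletelyRegularSpace.completely_regular (f x, g x)
      (V ×ˢ W)ᶜ (hV.prod hW).isClosed_compl (fun h => h ⟨hxV, hxW⟩)
    refine ⟨⟨fun q => φ q, by fun_prop⟩, V, W, hV, fun y hy z hz => hVW (mk_mem_prod hy hz), ?_, ?_⟩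
    · simp [hφ0]
    · intro q' hq'
      by_contra hn
      have := hφ1 hn
      norm_num [this] at hq'
  choose! φ V W hV hVW hφ hφV using key
  obtain ⟨t, htK, ht, hcov⟩ := ((hc A hA).isCompact_image_prodMk f g).elim_finite_subcover_image
    (b := (fun x => (f x, g x)) '' A) (c := fun q => {q' | φ q q' < 1 / 2})
    (fun q _ => isOpen_lt (φ q).continuous continuous_const)
    (fun q hq => mem_biUnion hq (hφ q hq))
  let h (q : (ι → ℝ) × (ι → ℝ)) : C(X, ℝ) := (φ q).comp (f.prodMk g)
  let B (q : (ι → ℝ) × (ι → ℝ)) : Set X := A ∩ h q ⁻¹' Iic (1 / 2)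
  have hnhds : (⋂ q ∈ t, {k : C(X, ι → ℝ) | MapsTo k (B q) (V q)}) ∈ 𝓝 f := by
    refine (Filter.biInter_mem ht).2 fun q hq => IsOpen.mem_nhds ?_ ?_
    · have hA' := hA
      rw [hΛ] at hA'
      exact hA'.2 _ inter_subset_left ((hc A hA).inter_preimage (h q) isClosed_Iic) _
        (hV q (htK hq))
    · exact fun x hx => (hφV q (htK hq) _ hx.2).1
  refine Filter.mem_of_superset hnhds fun k hk x hx => ?_
  obtain ⟨q, hq, hlt⟩ := mem_iUnion₂.1 (hcov (mem_image_of_mem _ hx))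
  have hxB : x ∈ B q := ⟨hx, mem_preimage.2 (mem_Iic.2 (mem_ofPred_eq ▸ hlt).le)⟩
  exact hVW q (htK hq) _ (mem_iInter₂.1 hk q hq hxB) _ (hφV q (htK hq) _ hxB.2).2

theorem continuous_const_setOpenTopology {Λ : Set (Set X)} (hΛ : ∀ A ∈ Λ, A.Nonempty) :
    Continuous[inferInstance, setOpenTopology ι Λ]
      (ContinuousMap.const X : (ι → ℝ) → C(X, ι → ℝ)) := by
  refine continuous_generateFrom_iff.2 ?_
  rintro _ ⟨A, hA, U, hU, rfl⟩
  convert hU using 1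
  ext c
  obtain ⟨a, ha⟩ := hΛ A hA
  exact ⟨fun h => h ha, fun h _ _ => h⟩

theorem isClosed_image_of_continuous_add_right {Λ : Set (Set X)} (hΛ : ∀ A ∈ Λ, A.Nonempty)
    (hadd : ∀ g : C(X, ι → ℝ),
      Continuous[setOpenTopology ι Λ, setOpenTopology ι Λ] (fun f => f + g))
    {A : Set X} (hA : A ∈ Λ) (g : C(X, ι → ℝ)) : IsClosed (g '' A) := by
  refine isClosed_of_closure_subset fun c hc => ?_
  by_contra hcA
  let := setOpenTopology (X := X) ι Λ
  have hopen := (isOpen_setOpenTopology hA (isOpen_compl_singleton (x := c))).preimage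
    ((hadd g).comp (continuous_const_setOpenTopology hΛ))
  have hneg : Continuous fun y : ι → ℝ => c - y := by fun_prop
  obtain ⟨_, hy, a, ha, rfl⟩ := mem_closure_iff.1 hc _ (hopen.preimage hneg) (by
    intro x hx
    simp only [Function.comp_apply, ContinuousMap.add_apply, ContinuousMap.const_apply, sub_self,
      zero_add, mem_compl_iff, mem_singleton_iff]
    exact fun h => hcA ⟨x, hx, h⟩)
  exact hy ha (sub_add_cancel c (g a))

theorem cCompactIn_of_isClosed_image {A : Set X}
    (hA : ∀ g : C(X, ι → ℝ), IsClosed (g '' A)) : CCompactIn ι A := by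
  intro g
  let G : C(X, ι → ℝ) := ⟨fun x i => Real.arctan (g x i), by fun_prop⟩
  have hsub : ∀ x i, G x i ∈ Ioo (-(Real.pi / 2)) (Real.pi / 2) := fun x i =>
    Real.arctan_mem_Ioo _
  have hG : IsCompact (G '' A) := by
    refine (isCompact_univ_pi fun _ : ι => isCompact_Icc (a := -(Real.pi / 2))
      (b := Real.pi / 2)).of_isClosed_subset (hA G) ?_
    rintro _ ⟨x, -, rfl⟩ i -
    exact Ioo_subset_Icc_self (hsub x i)
  have htan : ContinuousOn (fun (y : ι → ℝ) i => Real.tan (y i)) (G '' A) := by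
    refine continuousOn_pi.2 fun i => Real.continuousOn_tan_Ioo.comp
      (continuous_apply i).continuousOn ?_
    rintro _ ⟨x, -, rfl⟩
    exact hsub x i
  have := hG.image_of_continuousOn htan
  rw [image_image] at this
  simpa [G] using this

theorem isOpen_mapsTo_of_continuous_add_right {Λ : Set (Set X)}
    (hadd : ∀ g : C(X, ι → ℝ),
      Continuous[setOpenTopology ι Λ, setOpenTopology ι Λ] (fun f => f + g))
    {A B : Set X} (hA : A ∈ Λ) (hBA : B ⊆ A) (hB : CCompactIn ι B) {U : Set (ι → ℝ)}
    (hU : IsOpen U) : IsOpen[setOpenTopology ι Λ] {f : C(X, ι → ℝ) | MapsTo f B U} := by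
  let := setOpenTopology (X := X) ι Λ
  refine isOpen_iff_mem_nhds.2 fun f hf => ?_
  obtain ⟨W, hW, hWU⟩ := compact_open_separated_add_right (hB f) hU hf.image_subset
  have hopen := (isOpen_setOpenTopology hA (isOpen_interior (s := W))).preimage (hadd (-f))
  refine Filter.mem_of_superset (hopen.mem_nhds fun x _ => ?_) fun k hk x hx => ?_
  · simpa using mem_interior_iff_mem_nhds.2 hW
  · have := hWU (add_mem_add (mem_image_of_mem f hx) (interior_subset (hk (hBA hx))))
    simpa using this

end

theorem statement_2 {X : Type*} [TopologicalSpace X] [T35Space X]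
    (ι : Type*) [Nonempty ι] (Λ : Set (Set X)) (hΛ : ∀ A ∈ Λ, A.Nonempty) :
    ((∀ g : C(X, ι → ℝ),
        Continuous[setOpenTopology ι Λ, setOpenTopology ι Λ] (fun f => f + g) ∧
        Continuous[setOpenTopology ι Λ, setOpenTopology ι Λ] (fun f => g + f)) ∧
      Continuous[setOpenTopology ι Λ, setOpenTopology ι Λ]
        (fun f : C(X, ι → ℝ) => -f)) ↔
    (∀ A ∈ Λ, CCompactIn ι A) ∧ Λ = lambdaC ι Λ := by
  constructor
  · rintro ⟨hadd, -⟩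
    have hadd' := fun g => (hadd g).1
    refine ⟨fun A hA => cCompactIn_of_isClosed_image
      (isClosed_image_of_continuous_add_right hΛ hadd' hA), ?_⟩
    exact Subset.antisymm (fun A hA => ⟨hA, fun B hBA hB U hU =>
      isOpen_mapsTo_of_continuous_add_right hadd' hA hBA hB hU⟩) fun A hA => hA.1
  · rintro ⟨hc, hΛC⟩
    refine ⟨fun g => ⟨continuous_add_right_setOpenTopology hc hΛC g, ?_⟩,
      continuous_neg_setOpenTopology Λ⟩
    simpa only [add_comm g] using continuous_add_right_setOpenTopology hc hΛC g
end

section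
/- The maximal family λ_m := {A ⊆ X : A nonempty and [A,U] ∈ τ_λ for every open U ⊆ ℝ^ι} is a functional refinement family consisting of C_ι-compact subsets of X (i.e., every member of λ_m is C_ι-compact, and for every A ∈ λ_m, every finite sequence U₁,…,Uₙ of open subsets of ℝ^ι, and every continuous f : X → ℝ^ι with A ⊆ f⁻¹(U₁) ∪ … ∪ f⁻¹(Uₙ), there exist finitely many A₁,…,A_m ∈ λ_m, each contained in some f⁻¹(Uᵢ), with A ⊆ A₁ ∪ … ∪ A_m) if and only if every member of λ is C_ι-compact in X and λ = λ(C_ι). -/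
open Topology Set

/-- The maximal family `λ_m`: all nonempty `A ⊆ X` such that `[A,U]` is `τ_λ`-open for
every open `U ⊆ ℝ^ι`. -/
def lambdaM {X : Type*} [TopologicalSpace X] (ι : Type*) (Λ : Set (Set X)) : Set (Set X) :=
  {A | A.Nonempty ∧ ∀ U : Set (ι → ℝ), IsOpen U →
    IsOpen[setOpenTopology ι Λ] {f : C(X, ι → ℝ) | Set.MapsTo f A U}}

theorem exists_continuousMap_lt_of_mem_open {Y : Type*} [TopologicalSpace Y]
    [CompletelyRegularSpace Y] {U : Set Y} (hU : IsOpen U) {y : Y} (hy : y ∈ U) :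
    ∃ u : C(Y, ℝ), u y = 0 ∧ ∀ z ∉ U, u z = 1 := by
  obtain ⟨u, hu, hu0, hu1⟩ := CompletelyRegularSpace.completely_regular_isOpen y U hU hy
  refine ⟨⟨fun z => (u z : ℝ), by fun_prop⟩, by simp [hu0], fun z hz => ?_⟩
  have : u z = 1 := hu1 hz
  simp [this]

theorem IsCompact.exists_continuousMap_lt {Y : Type*} [TopologicalSpace Y]
    [CompletelyRegularSpace Y] {K U : Set Y} (hK : IsCompact K) (hU : IsOpen U) (hKU : K ⊆ U) :
    ∃ u : C(Y, ℝ), (∀ y ∈ K, u y < 1 / 3) ∧ ∀ z ∉ U, u z = 1 := by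
  refine hK.induction_on (p := fun K => ∃ u : C(Y, ℝ), (∀ y ∈ K, u y < 1 / 3) ∧
    ∀ z ∉ U, u z = 1) ⟨1, by simp, by simp⟩ ?_ ?_ ?_
  · rintro s t hst ⟨u, hu, hu1⟩
    exact ⟨u, fun y hy => hu y (hst hy), hu1⟩
  · rintro s t ⟨u, hu, hu1⟩ ⟨v, hv, hv1⟩
    refine ⟨u ⊓ v, ?_, fun z hz => by simp [hu1 z hz, hv1 z hz]⟩
    rintro y (hy | hy)
    · exact inf_lt_of_left_lt (hu y hy)
    · exact inf_lt_of_right_lt (hv y hy)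
  · intro y hy
    obtain ⟨u, hu0, hu1⟩ := exists_continuousMap_lt_of_mem_open hU (hKU hy)
    refine ⟨{z | u z < 1 / 3}, mem_nhdsWithin_of_mem_nhds ?_, u, fun _ h => h, hu1⟩
    exact (isOpen_lt u.continuous continuous_const).mem_nhds (by simp [hu0])

section SetOpen

variable {X : Type*} [TopologicalSpace X] {ι : Type*} {Λ : Set (Set X)}

theorem isOpen_setOpenTopology_mapsTo {A : Set X} (hA : A ∈ Λ) {U : Set (ι → ℝ)}
    (hU : IsOpen U) : IsOpen[setOpenTopology ι Λ] {f : C(X, ι → ℝ) | MapsTo f A U} :=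
  TopologicalSpace.isOpen_generateFrom_of_mem ⟨A, hA, U, hU, rfl⟩

theorem subset_lambdaM (hΛ : ∀ A ∈ Λ, A.Nonempty) : Λ ⊆ lambdaM ι Λ :=
  fun A hA => ⟨hΛ A hA, fun _ hU => isOpen_setOpenTopology_mapsTo hA hU⟩

theorem exists_finite_mapsTo_of_isOpen_setOpenTopology {O : Set C(X, ι → ℝ)}
    (hO : IsOpen[setOpenTopology ι Λ] O) {f : C(X, ι → ℝ)} (hf : f ∈ O) :
    ∃ T : Set (Set X × Set (ι → ℝ)), T.Finite ∧
      (∀ p ∈ T, p.1 ∈ Λ ∧ IsOpen p.2 ∧ MapsTo f p.1 p.2) ∧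
      ∀ g : C(X, ι → ℝ), (∀ p ∈ T, MapsTo g p.1 p.2) → g ∈ O := by
  change TopologicalSpace.GenerateOpen _ O at hO
  induction hO with
  | basic s hs =>
    obtain ⟨A, hA, U, hU, rfl⟩ := hs
    exact ⟨{(A, U)}, finite_singleton _, by simpa using ⟨hA, hU, hf⟩, fun g hg => hg _ rfl⟩
  | univ => exact ⟨∅, finite_empty, by simp, by simp⟩
  | inter s t _ _ hs ht =>
    obtain ⟨S, hS, hSf, hSg⟩ := hs hf.1
    obtain ⟨T, hT, hTf, hTg⟩ := ht hf.2
    refine ⟨S ∪ T, hS.union hT, fun p hp => hp.elim (hSf p) (hTf p), fun g hg => ⟨?_, ?_⟩⟩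
    · exact hSg g fun p hp => hg p (Or.inl hp)
    · exact hTg g fun p hp => hg p (Or.inr hp)
  | sUnion S _ ih =>
    obtain ⟨s, hs, hfs⟩ := hf
    obtain ⟨T, hT, hTf, hTg⟩ := ih s hs hfs
    exact ⟨T, hT, hTf, fun g hg => ⟨s, hs, hTg g hg⟩⟩

theorem isOpen_setOpenTopology_of_forall_exists {O : Set C(X, ι → ℝ)}
    (h : ∀ f ∈ O, ∃ T : Set (Set X × Set (ι → ℝ)), T.Finite ∧
      (∀ p ∈ T, IsOpen[setOpenTopology ι Λ] {g : C(X, ι → ℝ) | MapsTo g p.1 p.2} ∧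
        MapsTo f p.1 p.2) ∧
      ∀ g : C(X, ι → ℝ), (∀ p ∈ T, MapsTo g p.1 p.2) → g ∈ O) :
    IsOpen[setOpenTopology ι Λ] O := by
  refine (@isOpen_iff_forall_mem_open _ (setOpenTopology ι Λ) O).2 fun f hf => ?_
  obtain ⟨T, hT, hTf, hTg⟩ := h f hf
  refine ⟨⋂ p ∈ T, {g : C(X, ι → ℝ) | MapsTo g p.1 p.2}, fun g hg => hTg g ?_,
    @Set.Finite.isOpen_biInter _ _ (setOpenTopology ι Λ) _ _ hT fun p hp => (hTf p hp).1, ?_⟩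
  · simpa using hg
  · simpa using fun A U hp => (hTf (A, U) hp).2

theorem isCompact_image_pair_of_finite [Nonempty ι] [Finite ι] {A : Set X}
    (hA : CCompactIn ι A) (g : C(X, ι → ℝ)) (h : C(X, ℝ)) :
    IsCompact ((fun x => (g x, h x)) '' A) := by
  have : Fintype ι := Fintype.ofFinite ι
  obtain ⟨i⟩ := ‹Nonempty ι›
  have key : ∀ d : C(X, ℝ), IsCompact (d '' A) := fun d => by
    have := (hA ⟨fun x _ => d x, by fun_prop⟩).image (continuous_apply i)
    rwa [image_image] at this
  refine ((hA g).prod (key h)).of_isClosed_subset ?_ ?_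
  · refine isClosed_of_closure_subset fun p hp => ?_
    let d : C(X, ℝ) := ⟨fun x => dist (g x, h x) p, by fun_prop⟩
    have h0 : (0 : ℝ) ∈ closure (d '' A) := by
      rw [Metric.mem_closure_iff] at hp ⊢
      intro ε hε
      obtain ⟨_, ⟨x, hx, rfl⟩, hlt⟩ := hp ε hε
      refine ⟨d x, mem_image_of_mem _ hx, ?_⟩
      rw [dist_comm] at hlt
      simpa [d, abs_of_nonneg] using hlt
    rw [(key d).isClosed.closure_eq] at h0
    obtain ⟨x, hx, hx0⟩ := h0
    exact ⟨x, hx, dist_eq_zero.1 hx0⟩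
  · rintro _ ⟨x, hx, rfl⟩
    exact ⟨mem_image_of_mem _ hx, mem_image_of_mem _ hx⟩

theorem isCompact_image_pair_of_infinite [Infinite ι] {A : Set X}
    (hA : CCompactIn ι A) (g : C(X, ι → ℝ)) (h : C(X, ℝ)) :
    IsCompact ((fun x => (g x, h x)) '' A) := by
  obtain ⟨e⟩ : Nonempty (Option ι ≃ ι) := by
    rw [← Cardinal.eq, Cardinal.mk_option, Cardinal.mk_add_one_eq]
  let k : C(X, ι → ℝ) := ⟨fun x j => (e.symm j).elim (h x) (g x), continuous_pi fun j => by
    cases e.symm j <;> simp <;> fun_prop⟩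
  have := (hA k).image (f := fun y : ι → ℝ => ((fun i => y (e (some i))), y (e none)))
    (by fun_prop)
  rw [image_image] at this
  simpa [k] using this

theorem CCompactIn.isCompact_image_pair [Nonempty ι] {A : Set X}
    (hA : CCompactIn ι A) (g : C(X, ι → ℝ)) (h : C(X, ℝ)) :
    IsCompact ((fun x => (g x, h x)) '' A) := by
  cases finite_or_infinite ι
  · exact isCompact_image_pair_of_finite hA g h
  · exact isCompact_image_pair_of_infinite hA g h

theorem CCompactIn.inter_setOf_le [Nonempty ι] {A : Set X} (hA : CCompactIn ι A)
    (h : C(X, ℝ)) (c : ℝ) : CCompactIn ι (A ∩ {x | h x ≤ c}) := by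
  intro g
  have := ((hA.isCompact_image_pair g h).inter_right
    (isClosed_le continuous_snd (continuous_const (y := c)))).image continuous_fst
  convert this using 1
  ext y
  constructor
  · rintro ⟨x, ⟨hx, hxc⟩, rfl⟩
    exact ⟨(g x, h x), ⟨⟨x, hx, rfl⟩, hxc⟩, rfl⟩
  · rintro ⟨_, ⟨⟨x, hx, rfl⟩, hxc⟩, rfl⟩
    exact ⟨x, ⟨hx, hxc⟩, rfl⟩

theorem subset_closure_iUnion_of_forall_mapsTo [CompletelyRegularSpace X] [Nonempty ι] {A : Set X}
    {U : Set (ι → ℝ)} (hU : U ≠ univ) {T : Set (Set X × Set (ι → ℝ))} (f : C(X, ι → ℝ))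
    (hTf : ∀ p ∈ T, MapsTo f p.1 p.2)
    (hT : ∀ g : C(X, ι → ℝ), (∀ p ∈ T, MapsTo g p.1 p.2) → MapsTo g A U) :
    A ⊆ closure (⋃ p ∈ T, p.1) := by
  obtain ⟨y, hy⟩ := (ne_univ_iff_exists_notMem U).1 hU
  intro x hx
  by_contra hxc
  obtain ⟨u, hu0, hu1⟩ := exists_continuousMap_lt_of_mem_open isClosed_closure.isOpen_compl hxc
  let g : C(X, ι → ℝ) := ⟨fun z => y + u z • (f z - y), by fun_prop⟩
  have hg : MapsTo g A U := by
    refine hT g fun p hp z hz => ?_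
    have : u z = 1 := hu1 z (not_not.2 (subset_closure (mem_biUnion hp hz)))
    simpa [g, this] using hTf p hp hz
  exact hy (by simpa [g, hu0] using hg hx)

theorem exists_finite_subset_closure_of_mem_lambdaM [CompletelyRegularSpace X] [Nonempty ι]
    {A : Set X} (hA : A ∈ lambdaM ι Λ) :
    ∃ S ⊆ Λ, S.Finite ∧ A ⊆ closure (⋃₀ S) := by
  obtain ⟨T, hTfin, hTf, hT⟩ := exists_finite_mapsTo_of_isOpen_setOpenTopology
    (hA.2 {1}ᶜ isOpen_compl_singleton) (f := 0) fun x _ => by simp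
  refine ⟨Prod.fst '' T, ?_, hTfin.image _, ?_⟩
  · rintro _ ⟨p, hp, rfl⟩
    exact (hTf p hp).1
  · rw [sUnion_image]
    exact subset_closure_iUnion_of_forall_mapsTo (by simp) 0 (fun p hp => (hTf p hp).2.2) hT

open scoped Pointwise in
theorem cCompactIn_of_mem_lambdaM [CompletelyRegularSpace X] [Nonempty ι]
    (hΛ : ∀ A ∈ Λ, CCompactIn ι A) {A : Set X} (hA : A ∈ lambdaM ι Λ) : CCompactIn ι A := by
  intro f
  obtain ⟨S, hSΛ, hS, hAS⟩ := exists_finite_subset_closure_of_mem_lambdaM hA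
  have hK : IsCompact (f '' ⋃₀ S) := by
    rw [sUnion_eq_biUnion, image_iUnion₂]
    exact hS.isCompact_biUnion fun B hB => hΛ B (hSΛ hB) f
  refine hK.of_isClosed_subset (isClosed_of_closure_subset fun y hy => ?_) ?_
  · by_contra hyA
    obtain ⟨T, hTfin, hTf, hT⟩ := exists_finite_mapsTo_of_isOpen_setOpenTopology
      (hA.2 {y}ᶜ isOpen_compl_singleton) (f := f)
      fun x hx hxy => hyA ⟨x, hx, hxy⟩
    have hW : ∀ p ∈ T, ∃ W ∈ 𝓝 (0 : ι → ℝ), f '' p.1 + W ⊆ p.2 := fun p hp =>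
      compact_open_separated_add_right (hΛ _ (hTf p hp).1 f) (hTf p hp).2.1
        (hTf p hp).2.2.image_subset
    choose! W hW0 hWp using hW
    have hN : ⋂ p ∈ T, W p ∈ 𝓝 (0 : ι → ℝ) := (Filter.biInter_mem hTfin).2 hW0
    have hN' : (fun z => y - z) ⁻¹' (⋂ p ∈ T, W p) ∈ 𝓝 y := by
      refine ContinuousAt.preimage_mem_nhds (by fun_prop) ?_
      simpa using hN
    obtain ⟨_, hz, a, ha, rfl⟩ := mem_closure_iff_nhds.1 hy _ hN'
    let g : C(X, ι → ℝ) := ⟨fun x => f x + (y - f a), by fun_prop⟩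
    have hg := hT g fun p hp x hx =>
      hWp p hp (add_mem_add (mem_image_of_mem _ hx) (mem_iInter₂.1 hz p hp))
    exact hg ha (by simp [g])
  · rw [← hK.isClosed.closure_eq]
    exact (image_mono hAS).trans (image_closure_subset_closure_image f.continuous)

theorem CCompactIn.mem_lambdaM [Nonempty ι] (hΛ : ∀ A ∈ Λ, CCompactIn ι A)
    (hΛC : Λ ⊆ lambdaC ι Λ) {B : Set X} (hB : CCompactIn ι B) (hne : B.Nonempty)
    {S : Set (Set X)} (hSΛ : S ⊆ Λ) (hS : S.Finite) (hBS : B ⊆ closure (⋃₀ S)) :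
    B ∈ lambdaM ι Λ := by
  refine ⟨hne, fun U hU => isOpen_setOpenTopology_of_forall_exists fun f hf => ?_⟩
  obtain ⟨u, hu, hu1⟩ := (hB f).exists_continuousMap_lt hU (MapsTo.image_subset hf)
  let W : Set (ι → ℝ) := {y | u y < 1 / 2}
  let Z : Set X := {x | (u.comp f) x ≤ 1 / 3}
  refine ⟨(fun A => (A ∩ Z, W)) '' S, hS.image _, ?_, fun g hg x hx => ?_⟩
  · rintro _ ⟨A, hA, rfl⟩
    refine ⟨(hΛC (hSΛ hA)).2 _ inter_subset_left ((hΛ A (hSΛ hA)).inter_setOf_le _ _) _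
      (isOpen_lt u.continuous continuous_const), fun x hx => ?_⟩
    have : u (f x) ≤ 1 / 3 := hx.2
    change u (f x) < 1 / 2
    linarith
  · have hV : IsOpen {x | u (f x) < 1 / 3} := isOpen_lt (by fun_prop) continuous_const
    have hx' : x ∈ closure ({x | u (f x) < 1 / 3} ∩ ⋃₀ S) :=
      hV.inter_closure ⟨hu _ (mem_image_of_mem _ hx), hBS hx⟩
    have hle : closure ({x | u (f x) < 1 / 3} ∩ ⋃₀ S) ⊆ {x | u (g x) ≤ 1 / 2} := by
      refine closure_minimal ?_ (isClosed_le (by fun_prop) continuous_const)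
      rintro z ⟨hz, A, hA, hzA⟩
      have hzZ : z ∈ Z := le_of_lt (show u (f z) < 1 / 3 from hz)
      have hzW : g z ∈ W := hg _ (mem_image_of_mem _ hA) ⟨hzA, hzZ⟩
      exact le_of_lt (show u (g z) < 1 / 2 from hzW)
    by_contra hxU
    have h1 : u (g x) ≤ 1 / 2 := hle hx'
    rw [hu1 _ hxU] at h1
    norm_num at h1

theorem exists_lambdaM_refinement [CompletelyRegularSpace X] [Nonempty ι]
    (hΛ : ∀ A ∈ Λ, CCompactIn ι A) (hΛC : Λ ⊆ lambdaC ι Λ) {A : Set X} (hA : A ∈ lambdaM ι Λ)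
    {κ : Type*} {U : κ → Set (ι → ℝ)} (hU : ∀ i, IsOpen (U i)) (f : C(X, ι → ℝ))
    (hAU : A ⊆ ⋃ i, f ⁻¹' U i) :
    ∃ m : ℕ, ∃ B : Fin m → Set X, (∀ j, B j ∈ lambdaM ι Λ) ∧
      (∀ j, ∃ i, B j ⊆ f ⁻¹' U i) ∧ A ⊆ ⋃ j, B j := by
  have hAc := cCompactIn_of_mem_lambdaM hΛ hA
  obtain ⟨S, hSΛ, hS, hAS⟩ := exists_finite_subset_closure_of_mem_lambdaM hA
  have hloc : ∀ a : A, ∃ i, ∃ u : C(ι → ℝ, ℝ), u (f a) = 0 ∧ ∀ z ∉ U i, u z = 1 := fun a => by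
    obtain ⟨i, hi⟩ := mem_iUnion.1 (hAU a.2)
    exact ⟨i, exists_continuousMap_lt_of_mem_open (hU i) hi⟩
  choose i u hu0 hu1 using hloc
  obtain ⟨t, ht⟩ := (hAc f).elim_finite_subcover (fun a : A => {y | u a y < 1 / 2})
    (fun a => isOpen_lt (u a).continuous continuous_const) (by
      rintro _ ⟨a, ha, rfl⟩
      exact mem_iUnion.2 ⟨⟨a, ha⟩, by simp [hu0]⟩)
  let B : A → Set X := fun a => A ∩ {x | ((u a).comp f) x ≤ 1 / 2}
  let e := t.equivFin
  refine ⟨t.card, fun j => B (e.symm j), fun j => ?_, fun j => ⟨i (e.symm j), ?_⟩, fun x hx => ?_⟩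
  · exact (hAc.inter_setOf_le _ _).mem_lambdaM hΛ hΛC
      ⟨(e.symm j).1, (e.symm j).1.2, by simp [hu0]⟩ hSΛ hS (inter_subset_left.trans hAS)
  · rintro x ⟨-, hx⟩
    by_contra hxU
    have h1 : u (e.symm j) (f x) ≤ 1 / 2 := hx
    rw [hu1 _ _ hxU] at h1
    norm_num at h1
  · obtain ⟨a, hat, ha⟩ := mem_iUnion₂.1 (ht (mem_image_of_mem f hx))
    refine mem_iUnion.2 ⟨e ⟨a, hat⟩, hx, ?_⟩
    have : u a (f x) < 1 / 2 := ha
    simpa using this.le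

theorem isOpen_mapsTo_of_lambdaM_refinement {A B : Set X} (hBA : B ⊆ A) (hB : CCompactIn ι B)
    (href : ∀ n : ℕ, ∀ U : Fin n → Set (ι → ℝ), (∀ i, IsOpen (U i)) →
      ∀ f : C(X, ι → ℝ), A ⊆ ⋃ i, f ⁻¹' U i →
        ∃ m : ℕ, ∃ B : Fin m → Set X, (∀ j, B j ∈ lambdaM ι Λ) ∧
          (∀ j, ∃ i, B j ⊆ f ⁻¹' U i) ∧ A ⊆ ⋃ j, B j)
    {U : Set (ι → ℝ)} (hU : IsOpen U) :
    IsOpen[setOpenTopology ι Λ] {f : C(X, ι → ℝ) | MapsTo f B U} := by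
  refine isOpen_setOpenTopology_of_forall_exists fun f hf => ?_
  obtain ⟨m, D, hD, hDU, hAD⟩ := href 2 ![U, (f '' B)ᶜ]
    (by simpa [Fin.forall_fin_two] using ⟨hU, (hB f).isClosed⟩) f (fun x _ => by
      by_cases hx : f x ∈ f '' B
      · exact mem_iUnion.2 ⟨0, MapsTo.image_subset hf hx⟩
      · exact mem_iUnion.2 ⟨1, hx⟩)
  refine ⟨(fun j => (D j, U)) '' {j | D j ⊆ f ⁻¹' U}, (toFinite _).image _, ?_,
    fun g hg x hx => ?_⟩
  · rintro _ ⟨j, hj, rfl⟩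
    exact ⟨(hD j).2 U hU, hj⟩
  · obtain ⟨j, hj⟩ := mem_iUnion.1 (hAD (hBA hx))
    have hjU : D j ⊆ f ⁻¹' U := by
      obtain ⟨i, hi⟩ := hDU j
      fin_cases i
      · exact hi
      · exact absurd (mem_image_of_mem f hx) (hi hj)
    exact hg _ (mem_image_of_mem _ hjU) hj

end SetOpen

theorem statement_10 {X : Type*} [TopologicalSpace X] [T35Space X]
    (ι : Type*) [Nonempty ι] (Λ : Set (Set X)) (hΛ : ∀ A ∈ Λ, A.Nonempty) :
    ((∀ A ∈ lambdaM ι Λ, CCompactIn ι A) ∧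
      ∀ A ∈ lambdaM ι Λ, ∀ n : ℕ, ∀ U : Fin n → Set (ι → ℝ), (∀ i, IsOpen (U i)) →
        ∀ f : C(X, ι → ℝ), A ⊆ ⋃ i, ⇑f ⁻¹' U i →
          ∃ m : ℕ, ∃ B : Fin m → Set X, (∀ j, B j ∈ lambdaM ι Λ) ∧
            (∀ j, ∃ i, B j ⊆ ⇑f ⁻¹' U i) ∧ A ⊆ ⋃ j, B j) ↔
    (∀ A ∈ Λ, CCompactIn ι A) ∧ Λ = lambdaC ι Λ := by
  constructor
  · rintro ⟨hc, href⟩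
    have hsub := subset_lambdaM (ι := ι) hΛ
    refine ⟨fun A hA => hc A (hsub hA), Subset.antisymm (fun A hA => ⟨hA, ?_⟩) fun A hA => hA.1⟩
    exact fun B hBA hB U hU => isOpen_mapsTo_of_lambdaM_refinement hBA hB (href A (hsub hA)) hU
  · rintro ⟨hc, heq⟩
    exact ⟨fun A hA => cCompactIn_of_mem_lambdaM hc hA, fun A hA n U hU f hAU =>
      exists_lambdaM_refinement hc heq.subset hA hU f hAU⟩
end
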